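/- Let K₁ and K₂ be centered convex bodies in ℝ³ such that λ₂(K₁ ∩ u^⊥) ≤ λ₂(K₂ ∩ u^⊥) for every unit vector u ∈ S². Then λ₃(K₁) ≤ λ₃(K₂); that is, the Busemann–Petty problem has an affirmative answer in ℝ³. -/

import Mathlib

open MeasureTheory Metric
open scoped RealInnerProductSpace ENNReal

noncomputable section

abbrev E (n : ℕ) := EuclideanSpace ℝ (Fin n)

/-- The radial function of a set: `ρ_K(x) = max {c ≥ 0 : c • x ∈ K}`. -/
def radialFn {n : ℕ} (K : Set (E n)) (x : E n) : ℝ :=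
  sSup {c : ℝ | 0 ≤ c ∧ c • x ∈ K}

/-- A convex body: compact convex set with nonempty interior. -/
def IsConvexBody {n : ℕ} (K : Set (E n)) : Prop :=
  IsCompact K ∧ Convex ℝ K ∧ (interior K).Nonempty

/-- Centered: symmetric about the origin. -/
def IsCentered {n : ℕ} (K : Set (E n)) : Prop :=
  ∀ x, x ∈ K ↔ -x ∈ K

/-- The hyperplane through the origin orthogonal to `u`. -/
def hyperplane {n : ℕ} (u : E n) : Set (E n) := {x | ⟪x, u⟫ = 0}

/-- A star body: compact, star-shaped at the origin (contains the origin), with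
continuous radial function on the unit sphere. -/
def IsStarBody {n : ℕ} (L : Set (E n)) : Prop :=
  IsCompact L ∧ (0 : E n) ∈ L ∧ StarConvex ℝ 0 L ∧
    ContinuousOn (radialFn L) (sphere (0 : E n) 1)

/-- `L` is the intersection body of `M`: `ρ_L(u) = λ_{n-1}(M ∩ u^⊥)` for `u ∈ S^{n-1}`. -/
def IsIntersectionBodyOf {n : ℕ} (L M : Set (E n)) : Prop :=
  ∀ u ∈ sphere (0 : E n) 1,
    radialFn L u = (μH[(n : ℝ) - 1] (M ∩ hyperplane u)).toReal

/-- The spherical Radon transform: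
`(Rg)(u) = ∫_{S^{n-1} ∩ u^⊥} g dλ_{n-2}`. -/
def radon (n : ℕ) (g : E n → ℝ) (u : E n) : ℝ :=
  ∫ v in (sphere (0 : E n) 1 ∩ hyperplane u), g v ∂μH[(n : ℝ) - 2]

/-- A function on the sphere is C^∞ if its 0-homogeneous extension is smooth
away from the origin. -/
def SmoothOnSphere {n : ℕ} (h : E n → ℝ) : Prop :=
  ContDiffOn ℝ (⊤ : ℕ∞) (fun x : E n => h (‖x‖⁻¹ • x)) {(0 : E n)}ᶜ

/-- A body of revolution about the axis `u₀`: invariant under every (linear)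
isometry of `ℝⁿ` fixing `u₀`. -/
def IsRevolutionBody {n : ℕ} (u₀ : E n) (K : Set (E n)) : Prop :=
  ∀ f : E n ≃ₗᵢ[ℝ] E n, f u₀ = u₀ → f '' K = K

theorem lintegral_comp_mul_add {f : ℝ → ℝ≥0∞} (hf : Measurable f) {α : ℝ} (hα : α ≠ 0) (β : ℝ) :
    ∫⁻ q, f (α * q + β) = ENNReal.ofReal |α|⁻¹ * ∫⁻ q, f q := by
  have h1 : ∫⁻ q, f (α * q + β) = ∫⁻ q, f (q + β) ∂(Measure.map (fun x => α * x) volume) := by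
    rw [lintegral_map (by fun_prop) (by fun_prop)]
  rw [h1, Real.map_volume_mul_left hα, lintegral_smul_measure, lintegral_add_right_eq_self,
    smul_eq_mul, abs_inv]

theorem lintegral_inv_one_add_sq :
    ∫⁻ u : ℝ, ENNReal.ofReal (1 + u ^ 2)⁻¹ = ENNReal.ofReal Real.pi := by
  rw [← integral_univ_inv_one_add_sq, ofReal_integral_eq_lintegral_ofReal integrable_inv_one_add_sq]
  exact Filter.Eventually.of_forall fun x => by positivity

theorem lintegral_inv_quadratic {α β γ : ℝ} (hα : 0 < α) (hΔ : 0 < α * γ - β ^ 2) :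
    ∫⁻ q : ℝ, ENNReal.ofReal (α * q ^ 2 + 2 * β * q + γ)⁻¹ =
      ENNReal.ofReal (Real.pi / √(α * γ - β ^ 2)) := by
  set Δ := α * γ - β ^ 2 with hΔ'
  have hs : 0 < √Δ := Real.sqrt_pos.2 hΔ
  have hs2 : √Δ ^ 2 = Δ := Real.sq_sqrt hΔ.le
  have key : ∀ q : ℝ, ENNReal.ofReal (α * q ^ 2 + 2 * β * q + γ)⁻¹ =
      ENNReal.ofReal (α / Δ) * ENNReal.ofReal (1 + ((α / √Δ) * q + β / √Δ) ^ 2)⁻¹ := by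
    intro q
    rw [← ENNReal.ofReal_mul (by positivity)]
    congr 1
    have h2 : 1 + ((α / √Δ) * q + β / √Δ) ^ 2 = (α * (α * q ^ 2 + 2 * β * q + γ)) / Δ := by
      have : (α / √Δ) * q + β / √Δ = (α * q + β) / √Δ := by ring
      rw [this, div_pow, hs2]
      field_simp
      rw [hΔ']; ring
    rw [h2]
    by_cases h0 : α * q ^ 2 + 2 * β * q + γ = 0
    · simp [h0]
    · field_simp
  simp_rw [key]
  rw [lintegral_const_mul _ (by fun_prop),
    lintegral_comp_mul_add (f := fun u => ENNReal.ofReal (1 + u ^ 2)⁻¹) (by fun_prop)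
      (by positivity) _, lintegral_inv_one_add_sq, ← ENNReal.ofReal_mul (by positivity),
    ← ENNReal.ofReal_mul (by positivity)]
  congr 1
  rw [abs_of_pos (by positivity)]
  field_simp
  exact hs2

/-- The point of `ℝ³` with the given coordinates. -/
def vec3 (a b c : ℝ) : E 3 := !₂[a, b, c]

@[fun_prop]
theorem Continuous.vec3 {X : Type*} [TopologicalSpace X] {f g h : X → ℝ} (hf : Continuous f)
    (hg : Continuous g) (hh : Continuous h) : Continuous fun x => vec3 (f x) (g x) (h x) := by
  unfold _root_.vec3; fun_prop

@[fun_prop]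
theorem Measurable.vec3 {X : Type*} [MeasurableSpace X] {f g h : X → ℝ} (hf : Measurable f)
    (hg : Measurable g) (hh : Measurable h) : Measurable fun x => vec3 (f x) (g x) (h x) := by
  unfold _root_.vec3; fun_prop

theorem lintegral_vec3 {f : E 3 → ℝ≥0∞} (hf : Measurable f) :
    ∫⁻ X, f X = ∫⁻ a, ∫⁻ b, ∫⁻ c, f (vec3 a b c) := by
  have h1 := (EuclideanSpace.volume_preserving_symm_measurableEquiv_toLp (Fin 3)).symm
  have h2 := (volume_preserving_piFinSuccAbove (fun _ : Fin 3 => ℝ) 0).symm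
  have h3 := (volume_preserving_finTwoArrow ℝ).symm
  have m1 := hf.comp (MeasurableEquiv.toLp 2 (Fin 3 → ℝ)).symm.symm.measurable
  have m2 := m1.comp (MeasurableEquiv.piFinSuccAbove (fun _ : Fin 3 => ℝ) 0).symm.measurable
  refine (h1.lintegral_comp hf).symm.trans ((h2.lintegral_comp m1).symm.trans ?_)
  refine (lintegral_prod _ m2.aemeasurable).trans ?_
  congr 1
  ext a
  have h4 : ∀ g : (Fin 2 → ℝ) → ℝ≥0∞, Measurable g →
      ∫⁻ v, g v = ∫⁻ b, ∫⁻ c, g ![b, c] := by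
    intro g hg
    rw [← h3.lintegral_comp hg, Measure.volume_eq_prod, lintegral_prod _ (by fun_prop)]
    rfl
  refine (h4 _ (m2.comp measurable_prodMk_left)).trans ?_
  refine lintegral_congr fun b => lintegral_congr fun c => congrArg f ?_
  ext i
  fin_cases i <;> rfl

theorem lintegral_chart {f : E 3 → ℝ≥0∞} (hf : Measurable f) {G : ℝ → ℝ → ℝ≥0∞}
    (hG : Measurable fun x : ℝ × ℝ => G x.1 x.2) :
    ∫⁻ p, ∫⁻ q, (∫⁻ a, ∫⁻ b, f (vec3 a b (p * a + q * b))) * G p q =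
      ∫⁻ a, ∫⁻ b, ∫⁻ h, f (vec3 a b h) *
        ∫⁻ q, ENNReal.ofReal |a|⁻¹ * G ((h - q * b) / a) q := by
  have hG' : ∀ {X : Type} [MeasurableSpace X] {u v : X → ℝ}, Measurable u → Measurable v →
      Measurable fun x => G (u x) (v x) := fun hu hv => hG.comp (hu.prodMk hv)
  calc
    _ = ∫⁻ p, ∫⁻ q, ∫⁻ a, ∫⁻ b, f (vec3 a b (p * a + q * b)) * G p q := by
      congr 1; ext p; congr 1; ext q
      rw [← lintegral_mul_const _ (by fun_prop)]
      congr 1; ext a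
      rw [← lintegral_mul_const _ (by fun_prop)]
    _ = ∫⁻ x : ℝ × ℝ, ∫⁻ y : ℝ × ℝ, f (vec3 y.1 y.2 (x.1 * y.1 + x.2 * y.2)) * G x.1 x.2 := by
      rw [Measure.volume_eq_prod, lintegral_prod _ (by fun_prop)]
      congr 1; ext p; congr 1; ext q
      rw [lintegral_prod _ (by fun_prop)]
    _ = ∫⁻ y : ℝ × ℝ, ∫⁻ x : ℝ × ℝ, f (vec3 y.1 y.2 (x.1 * y.1 + x.2 * y.2)) * G x.1 x.2 :=
      lintegral_lintegral_swap (by unfold Function.uncurry; fun_prop)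
    _ = ∫⁻ a, ∫⁻ b, ∫⁻ q, ∫⁻ p, f (vec3 a b (p * a + q * b)) * G p q := by
      rw [Measure.volume_eq_prod, lintegral_prod _ (by fun_prop)]
      congr 1; ext a; congr 1; ext b
      rw [lintegral_prod_symm _ (by fun_prop)]
    _ = ∫⁻ a, ∫⁻ b, ∫⁻ q, ∫⁻ h, f (vec3 a b h) *
        (ENNReal.ofReal |a|⁻¹ * G ((h - q * b) / a) q) := by
      have h0 : ∀ᵐ a : ℝ, a ≠ 0 := by simp [ae_iff]
      refine lintegral_congr_ae (h0.mono fun a ha => ?_)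
      dsimp only
      congr 1; ext b; congr 1; ext q
      have hm : Measurable fun h => f (vec3 a b h) * G ((h - q * b) / a) q :=
        (by fun_prop : Measurable fun h => f (vec3 a b h)).mul
          (hG' (by fun_prop) (by fun_prop))
      have := lintegral_comp_mul_add hm ha (q * b)
      rw [← lintegral_const_mul _ hm] at this
      refine Eq.trans (lintegral_congr fun p => ?_) (this.trans (lintegral_congr fun h => ?_))
      · rw [add_sub_cancel_right, mul_div_cancel_left₀ _ ha, mul_comm p]
      · ring
    _ = _ := by
      congr 1; ext a; congr 1; ext b
      have hm : Measurable fun x : ℝ × ℝ => G ((x.1 - x.2 * b) / a) x.2 :=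
        hG' (by fun_prop) (by fun_prop)
      rw [lintegral_lintegral_swap]
      · congr 1; ext h
        rw [lintegral_const_mul]
        exact measurable_const.mul (hG' (by fun_prop) (by fun_prop))
      · have hm : Measurable fun x : ℝ × ℝ => G ((x.2 - x.1 * b) / a) x.1 :=
          hG' (by fun_prop) (by fun_prop)
        unfold Function.uncurry
        fun_prop

/-- The squared area of the parallelogram spanned by two vectors. -/
def crossSq (X Y : E 3) : ℝ := ‖X‖ ^ 2 * ‖Y‖ ^ 2 - ⟪X, Y⟫ ^ 2

theorem crossSq_nonneg (X Y : E 3) : 0 ≤ crossSq X Y := by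
  have h := pow_le_pow_left₀ (abs_nonneg _) (abs_real_inner_le_norm X Y) 2
  rw [sq_abs, mul_pow] at h
  exact sub_nonneg.2 h

@[fun_prop]
theorem Measurable.crossSq {Z : Type*} [MeasurableSpace Z] {f g : Z → E 3} (hf : Measurable f)
    (hg : Measurable g) : Measurable fun x => crossSq (f x) (g x) := by
  unfold _root_.crossSq; fun_prop

theorem norm_sq_vec3 (a b c : ℝ) : ‖vec3 a b c‖ ^ 2 = a ^ 2 + b ^ 2 + c ^ 2 := by
  simp [vec3, EuclideanSpace.real_norm_sq_eq, Fin.sum_univ_three]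

theorem inner_vec3 (a b c x y z : ℝ) : ⟪vec3 a b c, vec3 x y z⟫ = a * x + b * y + c * z := by
  simp [vec3, PiLp.inner_apply, Fin.sum_univ_three]; ring

theorem vec3_eta (X : E 3) : vec3 (X 0) (X 1) (X 2) = X := by
  ext i; fin_cases i <;> rfl

/-- The integral of `f` over the graph of `(a, b) ↦ p * a + q * b + t`,
in the measure of the parameters `(a, b)`. -/
def slab (f : E 3 → ℝ≥0∞) (p q t : ℝ) : ℝ≥0∞ := ∫⁻ a, ∫⁻ b, f (vec3 a b (p * a + q * b + t))

theorem measurable_slab {f : E 3 → ℝ≥0∞} (hf : Measurable f) :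
    Measurable fun x : ℝ × ℝ × ℝ => slab f x.1 x.2.1 x.2.2 := by
  unfold slab; fun_prop

@[fun_prop]
theorem Measurable.slab {Z : Type*} [MeasurableSpace Z] {f : E 3 → ℝ≥0∞} (hf : Measurable f)
    {u v w : Z → ℝ} (hu : Measurable u) (hv : Measurable v) (hw : Measurable w) :
    Measurable fun x => slab f (u x) (v x) (w x) :=
  (measurable_slab hf).comp (hu.prodMk (hv.prodMk hw))

theorem lintegral_mul_slab {g : E 3 → ℝ≥0∞} (hg : Measurable g) {W : ℝ → ℝ≥0∞}
    (hW : Measurable W) (p q : ℝ) :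
    ∫⁻ t, W t * slab g p q t = ∫⁻ X : E 3, g X * W (X 2 - p * X 0 - q * X 1) := by
  rw [lintegral_vec3 (by fun_prop)]
  calc
    _ = ∫⁻ t, ∫⁻ y : ℝ × ℝ, W t * g (vec3 y.1 y.2 (p * y.1 + q * y.2 + t)) := by
      refine lintegral_congr fun t => ?_
      rw [lintegral_const_mul _ (by fun_prop), Measure.volume_eq_prod,
        lintegral_prod _ (by fun_prop)]
      rfl
    _ = ∫⁻ y : ℝ × ℝ, ∫⁻ t, W t * g (vec3 y.1 y.2 (p * y.1 + q * y.2 + t)) :=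
      lintegral_lintegral_swap (by unfold Function.uncurry; fun_prop)
    _ = ∫⁻ a, ∫⁻ b, ∫⁻ t, W t * g (vec3 a b (p * a + q * b + t)) := by
      rw [Measure.volume_eq_prod, lintegral_prod _ (by fun_prop)]
    _ = _ := by
      refine lintegral_congr fun a => lintegral_congr fun b => ?_
      rw [← lintegral_add_right_eq_self _ (-(p * a + q * b))]
      refine lintegral_congr fun c => ?_
      rw [mul_comm]
      congr 2
      · congr 1; ring
      · simp [vec3]; ring

theorem lintegral_slab_chart {f : E 3 → ℝ≥0∞} (hf : Measurable f) {G : ℝ → ℝ → ℝ≥0∞}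
    (hG : Measurable fun x : ℝ × ℝ => G x.1 x.2) {k : E 3 → ℝ≥0∞} (hk : Measurable k)
    (h : ∀ a b h : ℝ, a ≠ 0 →
      ∫⁻ q, ENNReal.ofReal |a|⁻¹ * G ((h - q * b) / a) q = k (vec3 a b h)) :
    ∫⁻ p, ∫⁻ q, slab f p q 0 * G p q = ∫⁻ Y, f Y * k Y := by
  have := lintegral_chart hf hG
  simp only [slab, add_zero]
  rw [this, lintegral_vec3 (by fun_prop)]
  have h0 : ∀ᵐ a : ℝ, a ≠ 0 := by simp [ae_iff]
  refine lintegral_congr_ae (h0.mono fun a ha => ?_)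
  refine lintegral_congr fun b => lintegral_congr fun c => ?_
  rw [h a b c ha]

/-- The density used to average the parallel sections with normal direction `(-p, -q, 1)`. -/
def weight (ε p q t : ℝ) : ℝ≥0∞ := ENNReal.ofReal (t ^ 2 + ε ^ 2 * (1 + p ^ 2 + q ^ 2))⁻¹

@[fun_prop]
theorem Measurable.weight {Z : Type*} [MeasurableSpace Z] {ε : ℝ}
    {u v w : Z → ℝ} (hu : Measurable u) (hv : Measurable v) (hw : Measurable w) :
    Measurable fun x => weight ε (u x) (v x) (w x) := by
  unfold _root_.weight; fun_prop

theorem lintegral_weight {ε : ℝ} (hε : 0 < ε) (p q : ℝ) :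
    ∫⁻ t, weight ε p q t = ENNReal.ofReal (Real.pi / (ε * √(1 + p ^ 2 + q ^ 2))) := by
  have := lintegral_inv_quadratic (α := 1) (β := 0) (γ := ε ^ 2 * (1 + p ^ 2 + q ^ 2)) one_pos
    (by simp; positivity)
  simp only [one_mul, mul_zero, zero_mul, add_zero] at this
  unfold weight
  rw [this]
  congr 2
  rw [zero_pow two_ne_zero, sub_zero, Real.sqrt_mul (by positivity), Real.sqrt_sq hε.le]

theorem lintegral_slab_mul_weight {f g : E 3 → ℝ≥0∞} (hf : Measurable f) (hg : Measurable g)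
    {ε : ℝ} (hε : 0 < ε) :
    ∫⁻ p, ∫⁻ q, slab f p q 0 * ∫⁻ t, weight ε p q t * slab g p q t =
      ∫⁻ Y, f Y * ∫⁻ X, g X *
        ENNReal.ofReal (Real.pi / (ε * √(crossSq X Y + ε ^ 2 * ‖Y‖ ^ 2))) := by
  refine lintegral_slab_chart hf (G := fun p q => ∫⁻ t, weight ε p q t * slab g p q t)
    (by fun_prop) (k := fun Y => ∫⁻ X, g X *
        ENNReal.ofReal (Real.pi / (ε * √(crossSq X Y + ε ^ 2 * ‖Y‖ ^ 2)))) (by fun_prop) ?_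
  intro a b h ha
  calc
    _ = ∫⁻ q, ∫⁻ X : E 3, g X * (ENNReal.ofReal |a|⁻¹ *
          weight ε ((h - q * b) / a) q (X 2 - (h - q * b) / a * X 0 - q * X 1)) := by
      refine lintegral_congr fun q => ?_
      rw [lintegral_mul_slab hg (by fun_prop), ← lintegral_const_mul _ (by fun_prop)]
      refine lintegral_congr fun X => ?_
      ring
    _ = ∫⁻ X : E 3, ∫⁻ q, g X * (ENNReal.ofReal |a|⁻¹ *
          weight ε ((h - q * b) / a) q (X 2 - (h - q * b) / a * X 0 - q * X 1)) :=
      lintegral_lintegral_swap (by unfold Function.uncurry; fun_prop)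
    _ = _ := by
      refine lintegral_congr fun X => ?_
      rw [lintegral_const_mul _ (by fun_prop), lintegral_const_mul _ (by fun_prop)]
      congr 1
      set Y := vec3 a b h with hY
      have hN : ‖Y‖ ^ 2 = a ^ 2 + b ^ 2 + h ^ 2 := norm_sq_vec3 a b h
      have hC : crossSq X Y = (X 0 ^ 2 + X 1 ^ 2 + X 2 ^ 2) * (a ^ 2 + b ^ 2 + h ^ 2) -
          (X 0 * a + X 1 * b + X 2 * h) ^ 2 := by
        rw [crossSq, hN]
        rw [← vec3_eta X, norm_sq_vec3, hY, inner_vec3]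
        simp [vec3]
      have hC0 := crossSq_nonneg X Y
      have hY0 : 0 < ‖Y‖ ^ 2 := by rw [hN]; positivity
      have ha2 : 0 < a ^ 2 := by positivity
      have hdet : ((b * X 0 - a * X 1) ^ 2 + ε ^ 2 * (a ^ 2 + b ^ 2)) *
          ((a * X 2 - h * X 0) ^ 2 + ε ^ 2 * (a ^ 2 + h ^ 2)) -
          ((a * X 2 - h * X 0) * (b * X 0 - a * X 1) - ε ^ 2 * h * b) ^ 2 =
          a ^ 2 * (ε ^ 2 * (crossSq X Y + ε ^ 2 * ‖Y‖ ^ 2)) := by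
        rw [hC, hN]; ring
      have hq := lintegral_inv_quadratic
        (α := (b * X 0 - a * X 1) ^ 2 + ε ^ 2 * (a ^ 2 + b ^ 2))
        (β := (a * X 2 - h * X 0) * (b * X 0 - a * X 1) - ε ^ 2 * h * b)
        (γ := (a * X 2 - h * X 0) ^ 2 + ε ^ 2 * (a ^ 2 + h ^ 2)) (by positivity)
        (by rw [hdet]; positivity)
      rw [hdet, Real.sqrt_mul ha2.le, Real.sqrt_mul (by positivity), Real.sqrt_sq hε.le,
        Real.sqrt_sq_eq_abs] at hq
      have hw : ∀ q : ℝ, weight ε ((h - q * b) / a) q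
          (X 2 - (h - q * b) / a * X 0 - q * X 1) = ENNReal.ofReal (a ^ 2) *
          ENNReal.ofReal (((b * X 0 - a * X 1) ^ 2 + ε ^ 2 * (a ^ 2 + b ^ 2)) * q ^ 2 +
            2 * ((a * X 2 - h * X 0) * (b * X 0 - a * X 1) - ε ^ 2 * h * b) * q +
            ((a * X 2 - h * X 0) ^ 2 + ε ^ 2 * (a ^ 2 + h ^ 2)))⁻¹ := by
        intro q
        rw [weight, ← ENNReal.ofReal_mul ha2.le]
        congr 1
        have : (X 2 - (h - q * b) / a * X 0 - q * X 1) ^ 2 +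
            ε ^ 2 * (1 + ((h - q * b) / a) ^ 2 + q ^ 2) =
            (((b * X 0 - a * X 1) ^ 2 + ε ^ 2 * (a ^ 2 + b ^ 2)) * q ^ 2 +
            2 * ((a * X 2 - h * X 0) * (b * X 0 - a * X 1) - ε ^ 2 * h * b) * q +
            ((a * X 2 - h * X 0) ^ 2 + ε ^ 2 * (a ^ 2 + h ^ 2))) / a ^ 2 := by
          field_simp; ring
        rw [this, inv_div, div_eq_mul_inv]
      simp_rw [hw]
      rw [lintegral_const_mul _ (by fun_prop), hq, ← ENNReal.ofReal_mul ha2.le,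
        ← ENNReal.ofReal_mul (by positivity)]
      congr 1
      have hs : 0 < √(crossSq X Y + ε ^ 2 * ‖Y‖ ^ 2) := Real.sqrt_pos.2 (by positivity)
      have := abs_pos.2 ha
      rw [← sq_abs a]
      field_simp

theorem lintegral_slab_zero_mul_weight {f g : E 3 → ℝ≥0∞} (hf : Measurable f)
    (hg : Measurable g) {ε : ℝ} (hε : 0 < ε) :
    ∫⁻ p, ∫⁻ q, slab f p q 0 * ∫⁻ t, weight ε p q t * slab g p q 0 =
      ∫⁻ Y, f Y * ∫⁻ X, g X * ENNReal.ofReal (Real.pi / (ε * √(crossSq X Y))) := by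
  refine lintegral_slab_chart hf (G := fun p q => ∫⁻ t, weight ε p q t * slab g p q 0)
    (by fun_prop) (k := fun Y => ∫⁻ X, g X *
        ENNReal.ofReal (Real.pi / (ε * √(crossSq X Y)))) (by fun_prop) ?_
  intro a b h ha
  rw [lintegral_vec3 (by fun_prop)]
  set G : ℝ → ℝ≥0∞ := fun q =>
    ENNReal.ofReal (|a|⁻¹ * (Real.pi / (ε * √(1 + ((h - q * b) / a) ^ 2 + q ^ 2)))) with hG
  have hGm : Measurable G := by fun_prop
  calc
    _ = ∫⁻ q, ∫⁻ y : ℝ × ℝ, G q * g (vec3 y.1 y.2 ((h - q * b) / a * y.1 + q * y.2)) := by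
      refine lintegral_congr fun q => ?_
      rw [lintegral_mul_const _ (by fun_prop), lintegral_weight hε, ← mul_assoc,
        ← ENNReal.ofReal_mul (by positivity), lintegral_const_mul _ (by fun_prop),
        Measure.volume_eq_prod, lintegral_prod _ (by fun_prop)]
      simp only [slab, add_zero, hG]
    _ = ∫⁻ y : ℝ × ℝ, ∫⁻ q, G q * g (vec3 y.1 y.2 ((h - q * b) / a * y.1 + q * y.2)) :=
      lintegral_lintegral_swap (by unfold Function.uncurry; fun_prop)
    _ = ∫⁻ x, ∫⁻ y, ∫⁻ q, G q * g (vec3 x y ((h - q * b) / a * x + q * y)) := by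
      rw [Measure.volume_eq_prod, lintegral_prod _ (by fun_prop)]
    _ = _ := by
      refine lintegral_congr fun x => ?_
      have h0 : ∀ᵐ y : ℝ, y ≠ b * x / a := by simp [ae_iff]
      refine lintegral_congr_ae (h0.mono fun y hy => ?_)
      have hd : a * y - b * x ≠ 0 := by
        intro h; apply hy; field_simp; linarith
      set d := a * y - b * x with hd'
      dsimp only
      have hF : Measurable fun z => G ((z * a - h * x) / d) * g (vec3 x y z) := by fun_prop
      have hsub := lintegral_comp_mul_add hF (div_ne_zero hd ha) (h * x / a)
      rw [← lintegral_const_mul _ hF] at hsub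
      refine Eq.trans (lintegral_congr fun q => ?_) (hsub.trans (lintegral_congr fun z => ?_))
      · congr 2
        · field_simp; ring
        · congr 1; rw [hd']; field_simp; ring
      · rw [← mul_assoc, mul_comm (g _), hG, ← ENNReal.ofReal_mul (by positivity)]
        congr 2
        have hC : crossSq (vec3 x y z) (vec3 a b h) = d ^ 2 *
            (1 + ((h - (z * a - h * x) / d * b) / a) ^ 2 + ((z * a - h * x) / d) ^ 2) := by
          have hp : (h - (z * a - h * x) / d * b) / a = (h * y - z * b) / d := by
            field_simp; rw [hd']; ring
          rw [hp, crossSq, norm_sq_vec3, norm_sq_vec3, inner_vec3]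
          field_simp
          rw [hd']; ring
        rw [hC, Real.sqrt_mul (by positivity), Real.sqrt_sq_eq_abs, abs_div]
        have := abs_pos.2 ha
        have := abs_pos.2 hd
        field_simp

theorem ae_crossSq_pos {Y : E 3} (hY : Y ≠ 0) : ∀ᵐ X : E 3, 0 < crossSq X Y := by
  have hs : (volume : Measure (E 3)) (ℝ ∙ Y : Submodule ℝ (E 3)) = 0 := by
    refine Measure.addHaar_submodule _ _ fun h => ?_
    have h1 := finrank_span_singleton (K := ℝ) hY
    rw [h, finrank_top, finrank_euclideanSpace_fin] at h1
    norm_num at h1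
  refine measure_mono_null (fun X hX => ?_) hs
  have h0 : crossSq X Y = 0 := le_antisymm (not_lt.1 hX) (crossSq_nonneg X Y)
  by_cases hX0 : X = 0
  · simp [hX0]
  have h2 : ‖⟪Y, X⟫‖ = ‖Y‖ * ‖X‖ := by
    rw [real_inner_comm, Real.norm_eq_abs, ← abs_of_nonneg (by positivity : 0 ≤ ‖Y‖ * ‖X‖),
      ← sq_eq_sq_iff_abs_eq_abs]
    unfold crossSq at h0
    linarith
  obtain ⟨r, -, hr⟩ := (norm_inner_eq_norm_iff hY hX0).1 h2
  exact Submodule.mem_span_singleton.2 ⟨r, hr.symm⟩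

/-- The mollifying kernel whose integral against a body tends, up to a constant factor, to the
length of its chord in the direction `Y`. -/
def kern (ε : ℝ) (X Y : E 3) : ℝ≥0∞ :=
  ENNReal.ofReal (ε⁻¹ * ((√(crossSq X Y))⁻¹ - (√(crossSq X Y + ε ^ 2 * ‖Y‖ ^ 2))⁻¹))

@[fun_prop]
theorem Measurable.kern {Z : Type*} [MeasurableSpace Z] {f g : Z → E 3} {ε : ℝ}
    (hf : Measurable f) (hg : Measurable g) : Measurable fun x => kern ε (f x) (g x) := by
  unfold _root_.kern; fun_prop

theorem kern_add {ε : ℝ} (hε : 0 < ε) {X Y : E 3} (h : 0 < crossSq X Y) :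
    ENNReal.ofReal Real.pi * kern ε X Y +
      ENNReal.ofReal (Real.pi / (ε * √(crossSq X Y + ε ^ 2 * ‖Y‖ ^ 2))) =
      ENNReal.ofReal (Real.pi / (ε * √(crossSq X Y))) := by
  have h1 : √(crossSq X Y) ≤ √(crossSq X Y + ε ^ 2 * ‖Y‖ ^ 2) :=
    Real.sqrt_le_sqrt (by linarith [sq_nonneg (ε * ‖Y‖), mul_pow ε ‖Y‖ 2])
  have h2 := Real.sqrt_pos.2 h
  have h3 := h2.trans_le h1
  have h4 := inv_anti₀ h2 h1
  unfold kern
  rw [← ENNReal.ofReal_mul Real.pi_pos.le, ← ENNReal.ofReal_add]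
  · congr 1; field_simp; ring
  · have := sub_nonneg.2 h4
    positivity
  · positivity

theorem ae_ne_zero_E3 : ∀ᵐ Y : E 3, Y ≠ 0 := by
  simp [ae_iff]

theorem lintegral_slab_sub {f g : E 3 → ℝ≥0∞} (hf : Measurable f) (hg : Measurable g)
    (hfi : ∫⁻ Y, f Y * ENNReal.ofReal ‖Y‖⁻¹ ≠ ∞) (hgi : ∫⁻ X, g X ≠ ∞)
    (hs : ∀ p q t, slab g p q t ≤ slab g p q 0) {ε : ℝ} (hε : 0 < ε) :
    ∫⁻ p, ∫⁻ q, slab f p q 0 * ∫⁻ t, weight ε p q t * (slab g p q 0 - slab g p q t) =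
      ENNReal.ofReal Real.pi * ∫⁻ Y, f Y * ∫⁻ X, g X * kern ε X Y := by
  have hT := lintegral_slab_mul_weight hf hg hε
  have hS := lintegral_slab_zero_mul_weight hf hg hε
  have hfin : ∫⁻ Y, f Y * ∫⁻ X, g X *
      ENNReal.ofReal (Real.pi / (ε * √(crossSq X Y + ε ^ 2 * ‖Y‖ ^ 2))) ≠ ∞ := by
    refine ne_top_of_le_ne_top (b := (∫⁻ X, g X) * ENNReal.ofReal (Real.pi / ε ^ 2) *
      ∫⁻ Y, f Y * ENNReal.ofReal ‖Y‖⁻¹) (by finiteness) ?_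
    rw [← lintegral_const_mul _ (by fun_prop)]
    refine lintegral_mono_ae (ae_ne_zero_E3.mono fun Y hY => ?_)
    rw [mul_left_comm, mul_assoc, ← ENNReal.ofReal_mul (by positivity),
      ← lintegral_mul_const _ (by fun_prop)]
    gcongr with X
    have hY' := norm_pos_iff.2 hY
    have h1 : ε * ‖Y‖ ≤ √(crossSq X Y + ε ^ 2 * ‖Y‖ ^ 2) := by
      refine Real.le_sqrt_of_sq_le ?_
      rw [mul_pow]
      linarith [crossSq_nonneg X Y]
    have h2 : Real.pi / ε ^ 2 * ‖Y‖⁻¹ = Real.pi / (ε * (ε * ‖Y‖)) := by field_simp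
    rw [h2]
    gcongr
  refine (ENNReal.add_left_inj hfin).1 ?_
  rw [← hT]
  trans ∫⁻ p, ∫⁻ q, slab f p q 0 * ∫⁻ t, weight ε p q t * slab g p q 0
  · rw [← lintegral_add_left (by fun_prop)]
    refine lintegral_congr fun p => ?_
    rw [← lintegral_add_left (by fun_prop)]
    refine lintegral_congr fun q => ?_
    rw [← mul_add, ← lintegral_add_left (by fun_prop)]
    congr 1
    refine lintegral_congr fun t => ?_
    rw [← mul_add, tsub_add_cancel_of_le (hs p q t)]
  · rw [hT, hS, ← lintegral_const_mul _ (by fun_prop), ← lintegral_add_left (by fun_prop)]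
    refine lintegral_congr_ae (ae_ne_zero_E3.mono fun Y hY => ?_)
    dsimp only
    rw [mul_left_comm, ← mul_add, ← lintegral_const_mul (ENNReal.ofReal Real.pi) (by fun_prop),
      ← lintegral_add_left (by fun_prop)]
    congr 1
    refine lintegral_congr_ae ((ae_crossSq_pos hY).mono fun X hX => ?_)
    dsimp only
    rw [← kern_add hε hX]
    ring

theorem lintegral_kern_mono {f₁ f₂ g : E 3 → ℝ≥0∞} (hf₁ : Measurable f₁) (hf₂ : Measurable f₂)
    (hg : Measurable g) (hfi₁ : ∫⁻ Y, f₁ Y * ENNReal.ofReal ‖Y‖⁻¹ ≠ ∞)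
    (hfi₂ : ∫⁻ Y, f₂ Y * ENNReal.ofReal ‖Y‖⁻¹ ≠ ∞) (hgi : ∫⁻ X, g X ≠ ∞)
    (hs : ∀ p q t, slab g p q t ≤ slab g p q 0)
    (hle : ∀ p q, slab f₁ p q 0 ≤ slab f₂ p q 0) {ε : ℝ} (hε : 0 < ε) :
    ∫⁻ Y, f₁ Y * ∫⁻ X, g X * kern ε X Y ≤ ∫⁻ Y, f₂ Y * ∫⁻ X, g X * kern ε X Y := by
  have h1 := lintegral_slab_sub hf₁ hg hfi₁ hgi hs hε
  have h2 := lintegral_slab_sub hf₂ hg hfi₂ hgi hs hε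
  rw [← ENNReal.mul_le_mul_iff_right (a := ENNReal.ofReal Real.pi) (by simp [Real.pi_pos])
    ENNReal.ofReal_ne_top, ← h1, ← h2]
  gcongr with p q
  exact hle p q

/-- The profile of `kern` in the plane orthogonal to the chord direction. -/
def planeKern (x : ℝ × ℝ) : ℝ :=
  (√(x.1 ^ 2 + x.2 ^ 2))⁻¹ - (√(x.1 ^ 2 + x.2 ^ 2 + 1))⁻¹

@[fun_prop]
theorem measurable_planeKern : Measurable planeKern := by
  unfold planeKern; fun_prop

theorem planeKern_pos {x : ℝ × ℝ} (hx : x ≠ 0) : 0 < planeKern x := by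
  have h0 : 0 < x.1 ^ 2 + x.2 ^ 2 := by
    by_contra! h
    apply hx
    ext <;> simp <;> nlinarith [sq_nonneg x.1, sq_nonneg x.2]
  exact sub_pos.2 (inv_strictAnti₀ (Real.sqrt_pos.2 h0)
    (Real.sqrt_lt_sqrt h0.le (by linarith)))

theorem lintegral_planeKern_ne_zero : ∫⁻ x, ENNReal.ofReal (planeKern x) ≠ 0 := by
  refine ((lintegral_pos_iff_support (by fun_prop)).2 ?_).ne'
  refine lt_of_lt_of_le ?_ (measure_mono (s := {(0 : ℝ × ℝ)}ᶜ) fun x hx => ?_)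
  · exact (isOpen_compl_singleton).measure_pos _ ⟨(1, 1), by simp⟩
  · simpa using planeKern_pos hx

theorem lintegral_planeKern_ne_top : ∫⁻ x, ENNReal.ofReal (planeKern x) ≠ ∞ := by
  rw [← lintegral_comp_polarCoord_symm]
  refine ne_top_of_le_ne_top (b := ∫⁻ x in Set.univ ×ˢ Set.Ioo (-Real.pi) Real.pi,
    ENNReal.ofReal (1 + (x : ℝ × ℝ).1 ^ 2)⁻¹) ?_ ?_
  · rw [Measure.volume_eq_prod, ← Measure.prod_restrict, lintegral_prod _ (by fun_prop)]
    simp only [lintegral_const, Measure.restrict_univ]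
    rw [lintegral_mul_const _ (by fun_prop), lintegral_inv_one_add_sq]
    simp only [MeasurableSet.univ, Measure.restrict_apply, Set.univ_inter, Real.volume_Ioo]
    finiteness
  · refine (setLIntegral_mono' polarCoord.open_target.measurableSet fun x hx => ?_).trans
      (lintegral_mono_set (Set.prod_mono_left (Set.subset_univ _)))
    have hr : 0 < x.1 := hx.1
    rw [smul_eq_mul, ← ENNReal.ofReal_mul hr.le]
    refine ENNReal.ofReal_le_ofReal ?_
    have h1 : (x.1 * Real.cos x.2) ^ 2 + (x.1 * Real.sin x.2) ^ 2 = x.1 ^ 2 := by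
      linear_combination x.1 ^ 2 * Real.cos_sq_add_sin_sq x.2
    simp only [planeKern, polarCoord_symm_apply, h1, Real.sqrt_sq hr.le]
    have hs : 0 < √(x.1 ^ 2 + 1) := Real.sqrt_pos.2 (by positivity)
    have hs2 : √(x.1 ^ 2 + 1) ^ 2 = x.1 ^ 2 + 1 := Real.sq_sqrt (by positivity)
    have hlt : x.1 ≤ √(x.1 ^ 2 + 1) := Real.le_sqrt_of_sq_le (by linarith)
    set s := √(x.1 ^ 2 + 1)
    rw [add_comm 1, ← hs2, mul_sub, mul_inv_cancel₀ hr.ne']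
    have h3 : 1 - x.1 * s⁻¹ = (s ^ 2 - s * x.1) * (s ^ 2)⁻¹ := by field_simp
    rw [h3]
    have h4 : s ^ 2 - s * x.1 ≤ 1 := by nlinarith
    exact mul_le_of_le_one_left (by positivity) h4

theorem lintegral_eq_scale {f : ℝ → ℝ≥0∞} (hf : Measurable f) {ε : ℝ} (hε : 0 < ε) :
    ∫⁻ x, f x = ENNReal.ofReal ε * ∫⁻ z, f (ε * z) := by
  have := lintegral_comp_mul_add hf hε.ne' 0
  simp only [add_zero] at this
  rw [this, ← mul_assoc, ← ENNReal.ofReal_mul hε.le, abs_of_pos hε, mul_inv_cancel₀ hε.ne']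
  simp

theorem lintegral_mul_kern_axis {g : E 3 → ℝ≥0∞} (hg : Measurable g) {ε r : ℝ} (hε : 0 < ε)
    (hr : 0 < r) :
    ∫⁻ X, g X * kern ε X (vec3 0 0 r) =
      ∫⁻ x : (ℝ × ℝ) × ℝ, ENNReal.ofReal r⁻¹ * ENNReal.ofReal (planeKern x.1) *
        g (vec3 (ε * x.1.1) (ε * x.1.2) x.2) := by
  rw [lintegral_vec3 (by fun_prop), lintegral_eq_scale (by fun_prop) hε,
    Measure.volume_eq_prod, lintegral_prod _ (by fun_prop), Measure.volume_eq_prod,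
    lintegral_prod _ (by fun_prop), ← lintegral_const_mul _ (by fun_prop)]
  refine lintegral_congr fun a => ?_
  rw [lintegral_eq_scale (by fun_prop) hε, ← lintegral_const_mul _ (by fun_prop),
    ← lintegral_const_mul _ (by fun_prop)]
  refine lintegral_congr fun b => ?_
  rw [← lintegral_const_mul _ (by fun_prop), ← lintegral_const_mul _ (by fun_prop)]
  refine lintegral_congr fun c => ?_
  rw [mul_comm (g _), ← mul_assoc, ← mul_assoc]
  congr 1
  rw [kern, ← ENNReal.ofReal_mul hε.le, ← ENNReal.ofReal_mul (by positivity),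
    ← ENNReal.ofReal_mul (by positivity)]
  congr 1
  have h1 : crossSq (vec3 (ε * a) (ε * b) c) (vec3 0 0 r) = (ε * r) ^ 2 * (a ^ 2 + b ^ 2) := by
    rw [crossSq, norm_sq_vec3, norm_sq_vec3, inner_vec3]; ring
  have h2 : (ε * r) ^ 2 * (a ^ 2 + b ^ 2) + ε ^ 2 * ‖vec3 0 0 r‖ ^ 2 =
      (ε * r) ^ 2 * (a ^ 2 + b ^ 2 + 1) := by
    rw [norm_sq_vec3]; ring
  rw [h1, h2, Real.sqrt_mul (by positivity), Real.sqrt_mul (by positivity),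
    Real.sqrt_sq (by positivity), planeKern, mul_inv, mul_inv, mul_inv]
  field_simp

theorem exists_isometry_axis (Y : E 3) : ∃ U : E 3 ≃ₗᵢ[ℝ] E 3, U Y = vec3 0 0 ‖Y‖ := by
  refine ⟨(ℝ ∙ (Y - vec3 0 0 ‖Y‖))ᗮ.reflection, Submodule.reflection_sub ?_⟩
  rw [← Real.sqrt_sq (norm_nonneg (vec3 0 0 ‖Y‖)), norm_sq_vec3]
  simp

theorem kern_isometry (U : E 3 ≃ₗᵢ[ℝ] E 3) (ε : ℝ) (X Y : E 3) :
    kern ε (U X) (U Y) = kern ε X Y := by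
  simp [kern, crossSq]

theorem lintegral_mul_kern {g : E 3 → ℝ≥0∞} (hg : Measurable g) {ε : ℝ} (hε : 0 < ε) {Y : E 3}
    (hY : Y ≠ 0) {U : E 3 ≃ₗᵢ[ℝ] E 3} (hU : U Y = vec3 0 0 ‖Y‖) :
    ∫⁻ X, g X * kern ε X Y =
      ∫⁻ x : (ℝ × ℝ) × ℝ, ENNReal.ofReal ‖Y‖⁻¹ * ENNReal.ofReal (planeKern x.1) *
        g (U.symm (vec3 (ε * x.1.1) (ε * x.1.2) x.2)) := by
  have hUm : Measurable U.symm := U.symm.continuous.measurable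
  rw [← lintegral_mul_kern_axis (g := fun X => g (U.symm X)) (hg.comp hUm) hε (norm_pos_iff.2 hY),
    ← U.measurePreserving.lintegral_comp
      (f := fun X => g (U.symm X) * kern ε X (vec3 0 0 ‖Y‖)) (by fun_prop)]
  refine lintegral_congr fun X => ?_
  rw [U.symm_apply_apply, ← hU, kern_isometry]

/-- The integral of `g` over the line spanned by `Y`, parametrised by `s ↦ s • Y`. -/
def chord (g : E 3 → ℝ≥0∞) (Y : E 3) : ℝ≥0∞ := ∫⁻ s : ℝ, g (s • Y)

@[fun_prop]
theorem measurable_chord {g : E 3 → ℝ≥0∞} (hg : Measurable g) : Measurable (chord g) := by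
  unfold chord; fun_prop

theorem abs_le_norm_vec3 (a b c : ℝ) : |c| ≤ ‖vec3 a b c‖ := by
  have := norm_sq_vec3 a b c
  exact abs_le_of_sq_le_sq (by nlinarith [sq_nonneg a, sq_nonneg b]) (norm_nonneg _)

theorem indicator_axis_le {K : Set (E 3)} {R : ℝ} (hR : K ⊆ closedBall 0 R)
    (U : E 3 ≃ₗᵢ[ℝ] E 3) (a b c : ℝ) :
    K.indicator (1 : E 3 → ℝ≥0∞) (U.symm (vec3 a b c)) ≤ (Set.Icc (-R) R).indicator 1 c := by
  by_cases h : U.symm (vec3 a b c) ∈ K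
  · have h1 := hR h
    rw [mem_closedBall_zero_iff, LinearIsometryEquiv.norm_map] at h1
    have h2 := abs_le.1 ((abs_le_norm_vec3 a b c).trans h1)
    simp only [Set.indicator_of_mem h, Set.indicator_of_mem (Set.mem_Icc.2 h2)]; simp
  · simp [h]

theorem lintegral_axis_bound (R r : ℝ) :
    ∫⁻ x : (ℝ × ℝ) × ℝ, ENNReal.ofReal r⁻¹ * ENNReal.ofReal (planeKern x.1) *
        (Set.Icc (-R) R).indicator 1 x.2 =
      ENNReal.ofReal r⁻¹ * (∫⁻ x, ENNReal.ofReal (planeKern x)) * ENNReal.ofReal (2 * R) := by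
  have hm : Measurable ((Set.Icc (-R) R).indicator (1 : ℝ → ℝ≥0∞)) :=
    measurable_one.indicator measurableSet_Icc
  rw [Measure.volume_eq_prod, lintegral_prod_mul
    (f := fun x => ENNReal.ofReal r⁻¹ * ENNReal.ofReal (planeKern x)) (by fun_prop)
    hm.aemeasurable, lintegral_const_mul _ (by fun_prop),
    lintegral_indicator_one measurableSet_Icc, Real.volume_Icc]
  ring_nf

theorem lintegral_indicator_kern_le {K : Set (E 3)} (hK : MeasurableSet K) {R : ℝ}
    (hR : K ⊆ closedBall 0 R) {ε : ℝ} (hε : 0 < ε) {Y : E 3} (hY : Y ≠ 0) :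
    ∫⁻ X, K.indicator 1 X * kern ε X Y ≤
      ENNReal.ofReal ‖Y‖⁻¹ * (∫⁻ x, ENNReal.ofReal (planeKern x)) * ENNReal.ofReal (2 * R) := by
  obtain ⟨U, hU⟩ := exists_isometry_axis Y
  rw [lintegral_mul_kern (measurable_one.indicator hK) hε hY hU, ← lintegral_axis_bound]
  gcongr with x
  exact indicator_axis_le hR U _ _ _

theorem tendsto_indicator_of_notMem_frontier {X : Type*} [TopologicalSpace X] {K : Set X} {x : X}
    (hx : x ∉ frontier K) :
    Filter.Tendsto (K.indicator (1 : X → ℝ≥0∞)) (nhds x) (nhds (K.indicator 1 x)) := by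
  refine tendsto_const_nhds.congr' ?_
  by_cases h : x ∈ K
  · have hi : x ∈ interior K := by
      by_contra h'
      exact hx ⟨subset_closure h, h'⟩
    filter_upwards [isOpen_interior.mem_nhds hi] with y hy
    simp [h, interior_subset hy]
  · have hi : x ∈ (closure K)ᶜ := fun h' => hx ⟨h', fun h'' => h (interior_subset h'')⟩
    filter_upwards [isClosed_closure.isOpen_compl.mem_nhds hi] with y hy
    rw [Set.indicator_of_notMem h, Set.indicator_of_notMem fun h' => hy (subset_closure h')]

theorem ae_smul_notMem_frontier {V : Type*} [NormedAddCommGroup V] [NormedSpace ℝ V] {K : Set V}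
    (hK : Convex ℝ K) (h0 : K ∈ nhds 0) (Y : V) : ∀ᵐ s : ℝ, s • Y ∉ frontier K := by
  refine measure_mono_null (t := {(gauge K Y)⁻¹, -(gauge K (-Y))⁻¹}) (fun s hs => ?_)
    ((Set.toFinite _).measure_zero _)
  have hs : s • Y ∈ frontier K := not_not.1 hs
  rw [← gauge_eq_one_iff_mem_frontier hK h0] at hs
  rcases le_total 0 s with h | h
  · rw [gauge_smul_of_nonneg h, smul_eq_mul] at hs
    exact Or.inl (eq_inv_of_mul_eq_one_left hs)
  · rw [← neg_smul_neg, gauge_smul_of_nonneg (neg_nonneg.2 h), smul_eq_mul] at hs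
    exact Or.inr (neg_eq_iff_eq_neg.1 (eq_inv_of_mul_eq_one_left hs))

theorem tendsto_lintegral_indicator_kern {K : Set (E 3)} (hK : IsCompact K) (hKc : Convex ℝ K)
    (h0 : K ∈ nhds 0) {Y : E 3} (hY : Y ≠ 0) :
    Filter.Tendsto (fun n : ℕ => ∫⁻ X, K.indicator 1 X * kern (1 / ((n : ℝ) + 1)) X Y)
      Filter.atTop
      (nhds ((∫⁻ x, ENNReal.ofReal (planeKern x)) * chord (K.indicator 1) Y)) := by
  obtain ⟨U, hU⟩ := exists_isometry_axis Y
  obtain ⟨R, hR⟩ := hK.isBounded.subset_closedBall 0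
  have hr : 0 < ‖Y‖ := norm_pos_iff.2 hY
  have hχ : Measurable (K.indicator (1 : E 3 → ℝ≥0∞)) :=
    measurable_one.indicator hK.measurableSet
  have hUm : Measurable U.symm := U.symm.continuous.measurable
  have hUY : ∀ s : ℝ, U.symm (vec3 0 0 (‖Y‖ * s)) = s • Y := by
    intro s
    rw [U.symm_apply_eq, map_smul, hU]
    ext i; fin_cases i <;> simp [vec3, mul_comm]
  have hlim : (∫⁻ x, ENNReal.ofReal (planeKern x)) * chord (K.indicator 1) Y =
      ∫⁻ x : (ℝ × ℝ) × ℝ, ENNReal.ofReal ‖Y‖⁻¹ * ENNReal.ofReal (planeKern x.1) *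
        K.indicator 1 (U.symm (vec3 0 0 x.2)) := by
    rw [Measure.volume_eq_prod (ℝ × ℝ) ℝ, lintegral_prod_mul
      (f := fun x => ENNReal.ofReal ‖Y‖⁻¹ * ENNReal.ofReal (planeKern x))
      (g := fun s => K.indicator 1 (U.symm (vec3 0 0 s))) (by fun_prop) (by fun_prop),
      lintegral_const_mul _ (by fun_prop), lintegral_eq_scale (by fun_prop) hr]
    simp only [hUY, chord]
    rw [mul_mul_mul_comm, ← ENNReal.ofReal_mul (by positivity), inv_mul_cancel₀ hr.ne']
    simp
  rw [hlim]
  have hpos : ∀ n : ℕ, 0 < 1 / ((n : ℝ) + 1) := fun n => by positivity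
  simp_rw [fun n : ℕ => lintegral_mul_kern hχ (hpos n) hY hU]
  refine tendsto_lintegral_of_dominated_convergence
    (fun x => ENNReal.ofReal ‖Y‖⁻¹ * ENNReal.ofReal (planeKern x.1) *
        (Set.Icc (-R) R).indicator 1 x.2) (fun n => by fun_prop) (fun n => ?_) ?_ ?_
  · refine Filter.Eventually.of_forall fun x => ?_
    dsimp only
    gcongr
    exact indicator_axis_le hR U _ _ _
  · rw [lintegral_axis_bound]
    have := lintegral_planeKern_ne_top
    finiteness
  · have hae : ∀ᵐ τ : ℝ, U.symm (vec3 0 0 τ) ∉ frontier K := by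
      filter_upwards [ae_smul_notMem_frontier hKc h0 (U.symm (vec3 0 0 1))] with τ hτ
      rwa [← map_smul, show τ • vec3 0 0 1 = vec3 0 0 τ by
        ext i; fin_cases i <;> simp [vec3]] at hτ
    have hae' : ∀ᵐ x : (ℝ × ℝ) × ℝ, U.symm (vec3 0 0 x.2) ∉ frontier K :=
      (Measure.quasiMeasurePreserving_snd (μ := (volume : Measure (ℝ × ℝ)))
        (ν := (volume : Measure ℝ))).ae hae
    filter_upwards [hae'] with x hx
    refine ENNReal.Tendsto.const_mul ?_ (Or.inr (by finiteness))
    refine (tendsto_indicator_of_notMem_frontier hx).comp ?_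
    have hc : Continuous fun ε : ℝ => U.symm (vec3 (ε * x.1.1) (ε * x.1.2) x.2) := by fun_prop
    have := (hc.tendsto 0).comp tendsto_one_div_add_atTop_nhds_zero_nat
    simpa [Function.comp_def] using this

theorem lintegral_indicator_mul_inv_norm_ne_top {L : Set (E 3)} (hL : Bornology.IsBounded L) :
    ∫⁻ Y, L.indicator 1 Y * ENNReal.ofReal ‖Y‖⁻¹ ≠ ∞ := by
  obtain ⟨R, hR⟩ := hL.subset_ball 0
  have hint : IntegrableOn (fun Y : E 3 => ‖Y‖⁻¹) (ball 0 R) := by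
    refine integrableOn_ball_of_norm_le_rpow (C := 1) (α := 1) (by simp) (by simp) ?_
      (by fun_prop)
    refine Filter.Eventually.of_forall fun x => ?_
    simp [Real.rpow_neg_one]
  refine ne_top_of_le_ne_top hint.lintegral_lt_top.ne ?_
  rw [← lintegral_indicator measurableSet_ball]
  refine lintegral_mono fun Y => ?_
  by_cases h : Y ∈ L
  · simp only [Set.indicator_of_mem h, Set.indicator_of_mem (hR h)]; simp
  · simp [h]

theorem tendsto_lintegral_lintegral_kern {K L : Set (E 3)} (hK : IsCompact K)
    (hKc : Convex ℝ K) (h0 : K ∈ nhds 0) (hL : IsCompact L) :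
    Filter.Tendsto
      (fun n : ℕ => ∫⁻ Y, L.indicator 1 Y *
        ∫⁻ X, K.indicator 1 X * kern (1 / ((n : ℝ) + 1)) X Y) Filter.atTop
      (nhds ((∫⁻ x, ENNReal.ofReal (planeKern x)) *
        ∫⁻ Y, L.indicator 1 Y * chord (K.indicator 1) Y)) := by
  obtain ⟨R, hR⟩ := hK.isBounded.subset_closedBall 0
  have hχ : Measurable (K.indicator (1 : E 3 → ℝ≥0∞)) :=
    measurable_one.indicator hK.measurableSet
  have hχL : Measurable (L.indicator (1 : E 3 → ℝ≥0∞)) :=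
    measurable_one.indicator hL.measurableSet
  have hc := measurable_chord hχ
  rw [← lintegral_const_mul (f := fun Y => L.indicator 1 Y * chord (K.indicator 1) Y) _
    (hχL.mul hc)]
  refine tendsto_lintegral_of_dominated_convergence
    (fun Y => ((∫⁻ x, ENNReal.ofReal (planeKern x)) * ENNReal.ofReal (2 * R)) *
      (L.indicator 1 Y * ENNReal.ofReal ‖Y‖⁻¹)) (fun n => by fun_prop) (fun n => ?_) ?_ ?_
  · filter_upwards [ae_ne_zero_E3] with Y hY
    refine (mul_le_mul_right (lintegral_indicator_kern_le hK.measurableSet hR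
      (by positivity) hY) _).trans_eq ?_
    ring
  · have h1 := lintegral_planeKern_ne_top
    have h2 := lintegral_indicator_mul_inv_norm_ne_top hL.isBounded
    rw [lintegral_const_mul _ (by fun_prop)]
    finiteness
  · filter_upwards [ae_ne_zero_E3] with Y hY
    rw [mul_left_comm]
    refine ENNReal.Tendsto.const_mul (tendsto_lintegral_indicator_kern hK hKc h0 hY)
      (Or.inr ?_)
    by_cases h : Y ∈ L <;> simp [h]

theorem chord_le {K : Set (E 3)} {R : ℝ} (hR : K ⊆ closedBall 0 R) {Y : E 3} (hY : Y ≠ 0) :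
    chord (K.indicator 1) Y ≤ ENNReal.ofReal (2 * R) * ENNReal.ofReal ‖Y‖⁻¹ := by
  have hr := norm_pos_iff.2 hY
  calc
    _ ≤ ∫⁻ s, (Set.Icc (-(R / ‖Y‖)) (R / ‖Y‖)).indicator 1 s := by
      refine lintegral_mono fun s => ?_
      by_cases h : s • Y ∈ K
      · have h1 := hR h
        rw [mem_closedBall_zero_iff, norm_smul, Real.norm_eq_abs, ← le_div_iff₀ hr, abs_le] at h1
        simp only [Set.indicator_of_mem h, Set.indicator_of_mem (Set.mem_Icc.2 h1)]; simp
      · simp [h]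
    _ = _ := by
      rw [lintegral_indicator_one measurableSet_Icc, Real.volume_Icc,
        ← ENNReal.ofReal_mul' (by positivity)]
      congr 1; ring

theorem volume_add_volume_le_of_isCompact {S S' D : Set ℝ} (hS : IsCompact S) (hS' : IsCompact S')
    (hne : S.Nonempty) (hne' : S'.Nonempty) (h : ∀ x ∈ S, ∀ x' ∈ S', (x - x') / 2 ∈ D) :
    volume S + volume S' ≤ 2 * volume D := by
  obtain ⟨M, hM, hMax⟩ := hS.exists_isGreatest hne
  obtain ⟨M', hM', hMax'⟩ := hS'.exists_isGreatest hne'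
  have hP : volume ((fun z => z + M') ⁻¹' S) = volume S := measure_preimage_add_right _ _ _
  have hQ : volume ((fun z => M - z) ⁻¹' S') = volume S' :=
    (Measure.measurePreserving_sub_left volume M).measure_preimage hS'.measurableSet.nullMeasurableSet
  have hD : volume ((fun z => (2 : ℝ)⁻¹ * z) ⁻¹' D) = 2 * volume D := by
    rw [Real.volume_preimage_mul_left (by norm_num)]
    simp
  have hdisj : AEDisjoint volume ((fun z => z + M') ⁻¹' S) ((fun z => M - z) ⁻¹' S') := by
    refine measure_mono_null (t := {M - M'}) (fun z hz => ?_) (by simp)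
    have h1 := hMax hz.1
    have h2 := hMax' hz.2
    simp only [Set.mem_singleton_iff] at *
    linarith
  rw [← hP, ← hQ, ← hD, ← measure_union₀
    ((by fun_prop : Measurable fun z => M - z) hS'.measurableSet).nullMeasurableSet hdisj]
  refine measure_mono ?_
  rintro z (hz | hz)
  · have := h _ hz M' hM'
    simpa [div_eq_inv_mul] using this
  · have := h M hM _ hz
    simpa [div_eq_inv_mul] using this

theorem volume_le_of_half_sub_mem {S D : Set ℝ} (hS : MeasurableSet S)
    (h : ∀ x ∈ S, ∀ x' ∈ S, (x - x') / 2 ∈ D) : volume S ≤ volume D := by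
  rw [hS.measure_eq_iSup_isCompact]
  refine iSup₂_le fun T hT => iSup_le fun hTc => ?_
  rcases T.eq_empty_or_nonempty with rfl | hne
  · simp
  have := volume_add_volume_le_of_isCompact hTc hTc hne hne
    (fun x hx x' hx' => h x (hT hx) x' (hT hx'))
  rw [← two_mul] at this
  exact (ENNReal.mul_le_mul_iff_right two_ne_zero ENNReal.ofNat_ne_top).1 this

theorem lintegral_le_of_half_sub {l d : ℝ → ℝ≥0∞} (hl : Measurable l) (hd : Measurable d)
    (hl' : ∀ a, l a ≠ ∞) (hd' : ∀ a, d a ≠ ∞)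
    (h : ∀ a a', l a ≠ 0 → l a' ≠ 0 → l a + l a' ≤ 2 * d ((a - a') / 2)) :
    ∫⁻ a, l a ≤ ∫⁻ a, d a := by
  have key : ∀ {f : ℝ → ℝ≥0∞}, Measurable f → (∀ a, f a ≠ ∞) →
      ∫⁻ a, f a = ∫⁻ t in Set.Ioi (0 : ℝ), volume {a | t < (f a).toReal} := by
    intro f hf hf'
    rw [← lintegral_eq_lintegral_meas_lt volume (Filter.Eventually.of_forall fun a =>
      ENNReal.toReal_nonneg) (by fun_prop)]
    simp_rw [fun a => ENNReal.ofReal_toReal (hf' a)]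
  rw [key hl hl', key hd hd']
  refine setLIntegral_mono' measurableSet_Ioi fun t ht => ?_
  refine volume_le_of_half_sub_mem (measurableSet_lt (by fun_prop) (by fun_prop))
    fun a ha a' ha' => ?_
  have ht0 : (0 : ℝ) < t := ht
  simp only [Set.mem_ofPred_eq] at *
  have h0 : l a ≠ 0 := fun h0 => by simp [h0] at ha; linarith
  have h0' : l a' ≠ 0 := fun h0 => by simp [h0] at ha'; linarith
  have := ENNReal.toReal_mono (by have := hd' ((a - a') / 2); finiteness) (h a a' h0 h0')
  rw [ENNReal.toReal_add (hl' a) (hl' a'), ENNReal.toReal_mul, ENNReal.toReal_ofNat] at this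
  linarith

theorem lintegral_indicator_fiber {K : Set (E 3)} (hK : MeasurableSet K) (a p q t : ℝ) :
    ∫⁻ b, K.indicator 1 (vec3 a b (p * a + q * b + t)) =
      volume {b | vec3 a b (p * a + q * b + t) ∈ K} :=
  lintegral_indicator_one (μ := volume)
    ((by fun_prop : Measurable fun b => vec3 a b (p * a + q * b + t)) hK)

theorem isCompact_fiber {K : Set (E 3)} (hK : IsCompact K) (a p q t : ℝ) :
    IsCompact {b | vec3 a b (p * a + q * b + t) ∈ K} := by
  obtain ⟨R, hR⟩ := hK.isBounded.subset_closedBall 0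
  refine isCompact_of_isClosed_isBounded (hK.isClosed.preimage
    (by fun_prop : Continuous fun b => vec3 a b (p * a + q * b + t)))
    ((isBounded_closedBall (x := 0) (r := R)).subset fun b hb => ?_)
  have h1 := hR hb
  rw [mem_closedBall_zero_iff] at h1 ⊢
  have h2 := norm_sq_vec3 a b (p * a + q * b + t)
  have h3 : |b| ≤ ‖vec3 a b (p * a + q * b + t)‖ :=
    abs_le_of_sq_le_sq (by nlinarith [sq_nonneg a, sq_nonneg (p * a + q * b + t)])
      (norm_nonneg _)
  exact h3.trans h1

theorem slab_indicator_le {K : Set (E 3)} (hK : IsCompact K) (hKc : Convex ℝ K)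
    (hsymm : IsCentered K) (p q t : ℝ) :
    slab (K.indicator 1) p q t ≤ slab (K.indicator 1) p q 0 := by
  unfold slab
  simp_rw [lintegral_indicator_fiber hK.measurableSet]
  have hm : ∀ t, Measurable fun a => volume {b | vec3 a b (p * a + q * b + t) ∈ K} := by
    intro t
    simp_rw [← lintegral_indicator_fiber hK.measurableSet]
    have hχ : Measurable (K.indicator (1 : E 3 → ℝ≥0∞)) :=
      measurable_one.indicator hK.measurableSet
    fun_prop
  refine lintegral_le_of_half_sub (hm t) (hm 0)
    (fun a => (isCompact_fiber hK a p q t).measure_ne_top)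
    (fun a => (isCompact_fiber hK a p q 0).measure_ne_top) fun a a' ha ha' => ?_
  refine volume_add_volume_le_of_isCompact (isCompact_fiber hK a p q t)
    (isCompact_fiber hK a' p q t) (nonempty_of_measure_ne_zero ha)
    (nonempty_of_measure_ne_zero ha') fun b hb b' hb' => ?_
  have := hKc hb ((hsymm _).1 hb') (a := 1 / 2) (b := 1 / 2) (by norm_num) (by norm_num)
    (by norm_num)
  rw [Set.mem_ofPred_eq]
  convert this using 1
  ext i; fin_cases i <;> simp [vec3] <;> ring

theorem mem_hyperplane_iff {u : E 3} {c p q : ℝ} (hc : c ≠ 0) (hu : u = c • vec3 (-p) (-q) 1)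
    (X : E 3) : X ∈ hyperplane u ↔ X 2 = p * X 0 + q * X 1 := by
  rw [hyperplane, Set.mem_ofPred_eq, hu, inner_smul_right, mul_eq_zero, or_iff_right hc]
  nth_rw 1 [← vec3_eta X]
  rw [inner_vec3]
  constructor <;> intro h <;> linarith

/-- The linear parametrisation of the plane `z = p x + q y`. -/
def graphMap (p q : ℝ) : ℝ × ℝ →ₗ[ℝ] E 3 where
  toFun x := vec3 x.1 x.2 (p * x.1 + q * x.2)
  map_add' x y := by ext i; fin_cases i <;> simp [vec3]; ring
  map_smul' r x := by ext i; fin_cases i <;> simp [vec3]; ring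

theorem graphMap_injective (p q : ℝ) : Function.Injective (graphMap p q) := fun _ _ h =>
  Prod.ext (congrArg (fun X : E 3 => X 0) h) (congrArg (fun X : E 3 => X 1) h)

theorem slab_indicator_eq_volume {K : Set (E 3)} (hK : MeasurableSet K) (p q : ℝ) :
    slab (K.indicator 1) p q 0 = volume (graphMap p q ⁻¹' K) := by
  have hm : Measurable fun x : ℝ × ℝ => vec3 x.1 x.2 (p * x.1 + q * x.2) := by fun_prop
  have hχ : Measurable (K.indicator (1 : E 3 → ℝ≥0∞)) := measurable_one.indicator hK
  calc
    _ = ∫⁻ x : ℝ × ℝ, K.indicator 1 (vec3 x.1 x.2 (p * x.1 + q * x.2)) := by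
      rw [Measure.volume_eq_prod, lintegral_prod _ (by fun_prop)]
      simp [slab]
    _ = _ := lintegral_indicator_one (μ := volume) (hm hK)

theorem exists_hausdorffMeasure_inter_hyperplane (p q : ℝ) :
    ∃ u ∈ sphere (0 : E 3) 1, ∃ c : ℝ≥0∞, c ≠ 0 ∧ c ≠ ∞ ∧ ∀ K : Set (E 3), MeasurableSet K →
      μH[2] (K ∩ hyperplane u) = c * slab (K.indicator 1) p q 0 := by
  have hw : vec3 (-p) (-q) 1 ≠ 0 := fun h => by
    simpa [vec3] using congrArg (fun X : E 3 => X 2) h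
  let H := LinearMap.range (graphMap p q)
  let e : (ℝ × ℝ) ≃L[ℝ] H :=
    (LinearEquiv.ofInjective _ (graphMap_injective p q)).toContinuousLinearEquiv
  have hrank : Module.finrank ℝ H = 2 := by simp [← e.toLinearEquiv.finrank_eq]
  have hH : (H : Set (E 3)) = hyperplane (‖vec3 (-p) (-q) 1‖⁻¹ • vec3 (-p) (-q) 1) := by
    ext X
    rw [mem_hyperplane_iff (inv_ne_zero (norm_ne_zero_iff.2 hw)) rfl]
    constructor
    · rintro ⟨x, rfl⟩
      simp [graphMap, vec3]
    · intro h
      exact ⟨(X 0, X 1), by rw [← vec3_eta X, h]; rfl⟩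
  have : (μH[2] : Measure H).IsAddHaarMeasure := by
    have := isAddHaarMeasure_hausdorffMeasure (E := H)
    rwa [hrank, Nat.cast_ofNat] at this
  refine ⟨‖vec3 (-p) (-q) 1‖⁻¹ • vec3 (-p) (-q) 1, by simp [norm_smul, hw],
    Measure.addHaarScalarFactor ((μH[2] : Measure H).map e.symm) volume,
    mod_cast (Measure.addHaarScalarFactor_pos_of_isAddHaarMeasure _ _).ne',
    ENNReal.coe_ne_top, fun K hK => ?_⟩
  have hT := (graphMap p q).continuous_of_finiteDimensional.measurable hK
  have h := congrArg (fun ν : Measure (ℝ × ℝ) => ν (graphMap p q ⁻¹' K))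
    (Measure.isAddLeftInvariant_eq_smul ((μH[2] : Measure H).map e.symm) volume)
  simp only [Measure.smul_apply, ENNReal.smul_def, smul_eq_mul] at h
  rw [slab_indicator_eq_volume hK, ← h, Measure.map_apply e.symm.continuous.measurable hT,
    ← hH, Set.inter_comm, ← Subtype.image_preimage_coe,
    isometry_subtype_coe.hausdorffMeasure_image (Or.inl zero_le_two)]
  congr 1
  ext X
  exact iff_of_eq (congrArg (fun Z : H => (Z : E 3) ∈ K) (e.apply_symm_apply X).symm)

theorem hausdorffMeasure_le_iff_volume_le {K L : Set (E 3)} :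
    μH[3] K ≤ μH[3] L ↔ volume K ≤ volume L := by
  have : (μH[3] : Measure (E 3)).IsAddHaarMeasure := by
    have := isAddHaarMeasure_hausdorffMeasure (E := E 3)
    rwa [finrank_euclideanSpace_fin, Nat.cast_ofNat] at this
  rw [Measure.isAddLeftInvariant_eq_smul (μH[3] : Measure (E 3)) volume,
    Measure.smul_apply, Measure.smul_apply, ENNReal.smul_def, ENNReal.smul_def, smul_eq_mul,
    smul_eq_mul]
  exact ENNReal.mul_le_mul_iff_right
    (mod_cast (Measure.addHaarScalarFactor_pos_of_isAddHaarMeasure _ _).ne') ENNReal.coe_ne_top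

theorem IsConvexBody.mem_nhds_zero {n : ℕ} {K : Set (E n)} (hK : IsConvexBody K)
    (hc : IsCentered K) : K ∈ nhds 0 := by
  obtain ⟨x, hx⟩ := hK.2.2
  have := hK.2.1.combo_interior_self_mem_interior hx ((hc x).1 (interior_subset hx))
    (a := 1 / 2) (b := 1 / 2) (by norm_num) (by norm_num) (by norm_num)
  rw [smul_neg, add_neg_cancel] at this
  exact mem_interior_iff_mem_nhds.1 this

theorem measure_le_of_setLIntegral_le {X : Type*} [MeasurableSpace X] {μ : Measure X}
    {A B : Set X} (hA : MeasurableSet A) (hB : MeasurableSet B) {l : X → ℝ≥0∞} {c : ℝ≥0∞}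
    (hc : c ≠ 0) (hc' : c ≠ ∞) (h₁ : ∀ x ∈ A, c ≤ l x) (h₂ : ∀ x ∉ A, l x ≤ c)
    (hfin : ∫⁻ x in A, l x ∂μ ≠ ∞) (hle : ∫⁻ x in A, l x ∂μ ≤ ∫⁻ x in B, l x ∂μ) :
    μ A ≤ μ B := by
  rw [← lintegral_inter_add_sdiff l A hB, ← lintegral_inter_add_sdiff l B hA,
    Set.inter_comm B A] at hle
  have hfin' : ∫⁻ x in A ∩ B, l x ∂μ ≠ ∞ :=
    ne_top_of_le_ne_top hfin (lintegral_mono_set Set.inter_subset_left)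
  replace hle := (ENNReal.add_le_add_iff_left hfin').1 hle
  have hAB : c * μ (A \ B) ≤ ∫⁻ x in A \ B, l x ∂μ := by
    rw [← setLIntegral_const]
    exact setLIntegral_mono' (hA.diff hB) fun x hx => h₁ x hx.1
  have hBA : ∫⁻ x in B \ A, l x ∂μ ≤ c * μ (B \ A) := by
    rw [← setLIntegral_const]
    exact setLIntegral_mono' (hB.diff hA) fun x hx => h₂ x hx.2
  rw [← measure_inter_add_sdiff A hB, ← measure_inter_add_sdiff B hA, Set.inter_comm B A]
  gcongr 1
  exact (ENNReal.mul_le_mul_iff_right hc hc').1 (hAB.trans (hle.trans hBA))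

theorem IsCentered.smul_mem {n : ℕ} {K : Set (E n)} (hsymm : IsCentered K) (hKc : Convex ℝ K)
    {Y : E n} (hY : Y ∈ K) {s : ℝ} (hs : |s| ≤ 1) : s • Y ∈ K := by
  rw [abs_le] at hs
  have := hKc hY ((hsymm Y).1 hY) (a := (1 + s) / 2) (b := (1 - s) / 2)
    (by linarith) (by linarith) (by ring)
  convert this using 1
  module

theorem lintegral_indicator_Icc_neg_one_one :
    ∫⁻ s : ℝ, (Set.Icc (-1) 1).indicator 1 s = (2 : ℝ≥0∞) := by
  rw [lintegral_indicator_one measurableSet_Icc, Real.volume_Icc]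
  norm_num

theorem two_le_chord {K : Set (E 3)} (hKc : Convex ℝ K) (hsymm : IsCentered K) {Y : E 3}
    (hY : Y ∈ K) : 2 ≤ chord (K.indicator 1) Y := by
  rw [← lintegral_indicator_Icc_neg_one_one]
  refine lintegral_mono fun s => ?_
  by_cases hs : s ∈ Set.Icc (-1 : ℝ) 1
  · rw [Set.indicator_of_mem hs, Set.indicator_of_mem (hsymm.smul_mem hKc hY (abs_le.2 hs))]
    rfl
  · simp [hs]

theorem chord_le_two {K : Set (E 3)} (hKc : Convex ℝ K) (hsymm : IsCentered K) {Y : E 3}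
    (hY : Y ∉ K) : chord (K.indicator 1) Y ≤ 2 := by
  rw [← lintegral_indicator_Icc_neg_one_one]
  refine lintegral_mono fun s => ?_
  by_cases hs : s • Y ∈ K
  · have h : s ∈ Set.Icc (-1 : ℝ) 1 := by
      rw [Set.mem_Icc, ← abs_le]
      by_contra! h
      have h0 : s ≠ 0 := by rintro rfl; norm_num at h
      refine hY ?_
      rw [← inv_smul_smul₀ h0 Y]
      exact hsymm.smul_mem hKc hs (by rw [abs_inv]; exact (inv_lt_one_of_one_lt₀ h).le)
    rw [Set.indicator_of_mem hs, Set.indicator_of_mem h]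
    rfl
  · simp [hs]

theorem slab_indicator_le_of_section_le {K₁ K₂ : Set (E 3)} (hK₁ : MeasurableSet K₁)
    (hK₂ : MeasurableSet K₂)
    (hsec : ∀ u ∈ sphere (0 : E 3) 1,
      μH[2] (K₁ ∩ hyperplane u) ≤ μH[2] (K₂ ∩ hyperplane u)) (p q : ℝ) :
    slab (K₁.indicator 1) p q 0 ≤ slab (K₂.indicator 1) p q 0 := by
  obtain ⟨u, hu, c, hc, hc', h⟩ := exists_hausdorffMeasure_inter_hyperplane p q
  have := hsec u hu
  rw [h _ hK₁, h _ hK₂] at this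
  exact (ENNReal.mul_le_mul_iff_right hc hc').1 this

theorem setLIntegral_chord_le {K₁ K₂ : Set (E 3)} (hK₁ : IsConvexBody K₁) (hc₁ : IsCentered K₁)
    (hK₂ : IsCompact K₂) (hsec : ∀ u ∈ sphere (0 : E 3) 1,
      μH[2] (K₁ ∩ hyperplane u) ≤ μH[2] (K₂ ∩ hyperplane u)) :
    ∫⁻ Y in K₁, chord (K₁.indicator 1) Y ≤ ∫⁻ Y in K₂, chord (K₁.indicator 1) Y := by
  have h0 := hK₁.mem_nhds_zero hc₁
  have hind : ∀ {K : Set (E 3)}, MeasurableSet K →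
      ∫⁻ Y in K, chord (K₁.indicator 1) Y = ∫⁻ Y, K.indicator 1 Y * chord (K₁.indicator 1) Y := by
    intro K hK
    rw [← lintegral_indicator hK]
    refine lintegral_congr fun Y => ?_
    by_cases h : Y ∈ K <;> simp [h]
  have hm : ∀ {K : Set (E 3)}, IsCompact K → Measurable (K.indicator (1 : E 3 → ℝ≥0∞)) :=
    fun hK => measurable_one.indicator hK.measurableSet
  rw [hind hK₁.1.measurableSet, hind hK₂.measurableSet]
  refine (ENNReal.mul_le_mul_iff_right lintegral_planeKern_ne_zero
    lintegral_planeKern_ne_top).1 ?_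
  refine le_of_tendsto_of_tendsto' (tendsto_lintegral_lintegral_kern hK₁.1 hK₁.2.1 h0 hK₁.1)
    (tendsto_lintegral_lintegral_kern hK₁.1 hK₁.2.1 h0 hK₂) fun n => ?_
  refine lintegral_kern_mono (hm hK₁.1) (hm hK₂) (hm hK₁.1)
    (lintegral_indicator_mul_inv_norm_ne_top hK₁.1.isBounded)
    (lintegral_indicator_mul_inv_norm_ne_top hK₂.isBounded) ?_
    (slab_indicator_le hK₁.1 hK₁.2.1 hc₁)
    (slab_indicator_le_of_section_le hK₁.1.measurableSet hK₂.measurableSet hsec) (by positivity)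
  rw [lintegral_indicator_one hK₁.1.measurableSet]
  exact hK₁.1.measure_ne_top

theorem setLIntegral_chord_ne_top {K L : Set (E 3)} (hK : Bornology.IsBounded K)
    (hL : IsCompact L) : ∫⁻ Y in L, chord (K.indicator 1) Y ≠ ∞ := by
  obtain ⟨R, hR⟩ := hK.subset_closedBall 0
  refine ne_top_of_le_ne_top (ENNReal.mul_ne_top (a := ENNReal.ofReal (2 * R)) (by finiteness)
    (lintegral_indicator_mul_inv_norm_ne_top hL.isBounded)) ?_
  rw [← lintegral_indicator hL.measurableSet, ← lintegral_const_mul' _ _ (by finiteness)]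
  refine lintegral_mono_ae ?_
  filter_upwards [ae_ne_zero_E3] with Y hY
  by_cases h : Y ∈ L
  · simpa [h] using chord_le hR hY
  · simp [h]

/-- The Busemann–Petty problem has an affirmative answer in `ℝ³`. -/
theorem busemann_petty_dim_three (K₁ K₂ : Set (E 3))
    (hK₁ : IsConvexBody K₁) (hc₁ : IsCentered K₁)
    (hK₂ : IsConvexBody K₂) (hc₂ : IsCentered K₂)
    (hsec : ∀ u ∈ sphere (0 : E 3) 1,
      μH[2] (K₁ ∩ hyperplane u) ≤ μH[2] (K₂ ∩ hyperplane u)) :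
    μH[3] K₁ ≤ μH[3] K₂ := by
  exact hausdorffMeasure_le_iff_volume_le.2 <| measure_le_of_setLIntegral_le
    hK₁.1.measurableSet hK₂.1.measurableSet two_ne_zero ENNReal.ofNat_ne_top
    (fun _ => two_le_chord hK₁.2.1 hc₁) (fun _ => chord_le_two hK₁.2.1 hc₁)
    (setLIntegral_chord_ne_top hK₁.1.isBounded hK₁.1)
    (setLIntegral_chord_le hK₁ hc₁ hK₂.1 hsec)
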